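/- Let (x_i) be a normalized block sequence in T_k(d,θ) and (v_i) ⊆ ω^{[k]} with v_1 ≤ x_1 < v_2 ≤ x_2 < v_3 ≤ x_3 < …, supp(x_i) ⊆ X_{v_i}^max, and v_{i+1} ∈ X_{v_i}^max for all i. Then for any scalars (a_i), (1/(2d)) (Σ|a_i|^p)^{1/p} ≤ ‖Σ a_i x_i‖ ≤ (2/θ)(Σ|a_i|^p)^{1/p}, where dθ = d^{1/p}; hence (x_i) is equivalent to the unit vector basis of ℓ_p. -/

import Mathlib

/-- Non-decreasing list of naturals. -/
abbrev NonDec (l : List ℕ) : Prop := l.Chain' (· ≤ ·)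

/-- The order `≺` on nondecreasing sequences: the empty sequence is minimal;
nonempty sequences are compared by last entry, with lexicographic tie-breaking. -/
def prec (s t : List ℕ) : Prop :=
  (s = [] ∧ t ≠ []) ∨
  (s ≠ [] ∧ t ≠ [] ∧ (s.getLast! < t.getLast! ∨
    (s.getLast! = t.getLast! ∧ List.Lex (· < ·) s t)))

/-- The map `X̂_v`: `(m_1,…,m_l) ↦ (f_1(m_1),…,f_l(m_l))` where
`f_j(0) = n_j` and `f_j(m) = n_k + m` for `m ≥ 1`, `v = (n_1,…,n_k)`. -/
def Xhat (v s : List ℕ) : List ℕ :=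
  List.zipWith (fun a b => if b = 0 then a else v.getLast! + b) (v.take s.length) s

/-- The set `X_v^max`, described by its characterization:
`w ∈ X_v^max` iff `w` is nondecreasing of the same length as `v` and either
`w_1 > n_k`, or there is `1 ≤ i ≤ k` with `(w_1,…,w_i) = (n_1,…,n_i)` and
(if `i < k`) `w_{i+1} > n_k`. -/
def XmaxSet (v : List ℕ) : Set (List ℕ) :=
  { w | w.length = v.length ∧ NonDec w ∧
    (v.getLast! < w.headI ∨
      ∃ i, 1 ≤ i ∧ i ≤ v.length ∧ w.take i = v.take i ∧
        (i < v.length → v.getLast! < w.getD i 0)) }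

/-- An `E_k`-tree: a map on `ω^{≤k}` sending nondecreasing sequences of length `≤ k`
to nondecreasing sequences of the same length, preserving `≺` and initial segments. -/
def IsEkTree (k : ℕ) (X : List ℕ → List ℕ) : Prop :=
  (∀ s, NonDec s → s.length ≤ k → NonDec (X s) ∧ (X s).length = s.length) ∧
  (∀ s t, NonDec s → NonDec t → s.length ≤ k → t.length ≤ k →
    (prec s t → prec (X s) (X t)) ∧ (s <+: t → X s <+: X t))

/-- `E ∈ AR^k`: `E` is a finite `≺`-initial segment of the restriction to `ω^{[k]}`
of some `E_k`-tree. -/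
def memAR (k : ℕ) (E : Finset (List ℕ)) : Prop :=
  ∃ X : List ℕ → List ℕ, IsEkTree k X ∧
    (∀ e ∈ E, ∃ s, NonDec s ∧ s.length = k ∧ e = X s) ∧
    (∀ s, NonDec s → s.length = k → ∀ e ∈ E, prec (X s) e → X s ∈ E)

/-- `ω^{[k]}`: nondecreasing sequences of naturals of length exactly `k`. -/
abbrev Vec (k : ℕ) := {l : List ℕ // NonDec l ∧ l.length = k}

/-- Restriction `Ex` of a finitely supported vector to a set of coordinates. -/
noncomputable def restrict {k : ℕ} (E : Finset (Vec k)) (x : Vec k →₀ ℝ) : Vec k →₀ ℝ :=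
  x.filter (fun v => v ∈ E)

/-- `A < B`: every element of `A` is `≺`-below every element of `B`. -/
def Successive {k : ℕ} (A B : Finset (Vec k)) : Prop :=
  ∀ a ∈ A, ∀ b ∈ B, prec a.1 b.1

/-- Membership in `AR^k` for finite sets of elements of `ω^{[k]}`. -/
def memARV (k : ℕ) (E : Finset (Vec k)) : Prop :=
  memAR k (E.image Subtype.val)

/-- A `d`-admissible sequence: at most `d` many `≺`-successive members of `AR^k`. -/
def Admissible (k d : ℕ) {m : ℕ} (E : Fin m → Finset (Vec k)) : Prop :=
  m ≤ d ∧ (∀ i, memARV k (E i)) ∧ ∀ i j, i < j → Successive (E i) (E j)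

/-- The nondecreasing sequence of norms `|x|_j` defining the Tsirelson-type norm:
`|x|_0 = max |x_v|`, and `|x|_{j+1}` is the max of `|x|_j` and
`θ ∑ |E_i x|_j` over admissible sequences `(E_i)_{i=1}^m`, `1 ≤ m ≤ d`. -/
noncomputable def normSeq (k d : ℕ) (θ : ℝ) : ℕ → (Vec k →₀ ℝ) → ℝ
  | 0, x => ⨆ v, |x v|
  | j + 1, x => max (normSeq k d θ j x)
      (sSup { r | ∃ m : ℕ, 1 ≤ m ∧ ∃ E : Fin m → Finset (Vec k),
        Admissible k d E ∧ r = θ * ∑ i, normSeq k d θ j (restrict (E i) x) })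

/-- The norm of `T_k(d,θ)` on finitely supported vectors. -/
noncomputable def tnorm (k d : ℕ) (θ : ℝ) (x : Vec k →₀ ℝ) : ℝ :=
  ⨆ j, normSeq k d θ j x

section Order

theorem prec_irrefl (s : List ℕ) : ¬ prec s s := by
  rintro (⟨h, h'⟩ | ⟨-, -, h | ⟨-, h⟩⟩)
  · exact h' h
  · exact lt_irrefl _ h
  · exact lt_irrefl (α := List ℕ) s h

theorem prec_trans {s t u : List ℕ} (h : prec s t) (h' : prec t u) : prec s u := by
  rcases h with ⟨hs, ht⟩ | ⟨hs, ht, h⟩ <;> rcases h' with ⟨ht', hu⟩ | ⟨ht', hu, h'⟩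
  · exact absurd ht' ht
  · exact Or.inl ⟨hs, hu⟩
  · exact absurd ht' ht
  · refine Or.inr ⟨hs, hu, ?_⟩
    rcases h with h | ⟨h, hl⟩ <;> rcases h' with h' | ⟨h', hl'⟩
    · exact Or.inl (h.trans h')
    · exact Or.inl (h' ▸ h)
    · exact Or.inl (h ▸ h')
    · exact Or.inr ⟨h.trans h', lt_trans (α := List ℕ) hl hl'⟩

theorem prec_asymm {s t : List ℕ} (h : prec s t) : ¬ prec t s :=
  fun h' => prec_irrefl s (prec_trans h h')

end Order

section Norm

variable {k d : ℕ} {θ : ℝ}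

theorem restrict_apply (E : Finset (Vec k)) (x : Vec k →₀ ℝ) (w : Vec k) [Decidable (w ∈ E)] :
    restrict E x w = if w ∈ E then x w else 0 := by
  classical
  rw [restrict, Finsupp.filter_apply]
  congr

theorem restrict_add (E : Finset (Vec k)) (x y : Vec k →₀ ℝ) :
    restrict E (x + y) = restrict E x + restrict E y := Finsupp.filter_add

theorem restrict_smul (E : Finset (Vec k)) (c : ℝ) (x : Vec k →₀ ℝ) :
    restrict E (c • x) = c • restrict E x := Finsupp.filter_smul

theorem restrict_sum {ι : Type*} (E : Finset (Vec k)) (s : Finset ι) (x : ι → Vec k →₀ ℝ) :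
    restrict E (∑ i ∈ s, x i) = ∑ i ∈ s, restrict E (x i) := Finsupp.filter_sum s x

theorem restrict_comm (E F : Finset (Vec k)) (x : Vec k →₀ ℝ) :
    restrict E (restrict F x) = restrict F (restrict E x) := by
  classical
  ext w
  simp only [restrict_apply]
  split_ifs <;> rfl

theorem support_restrict_subset (E : Finset (Vec k)) (x : Vec k →₀ ℝ) :
    (restrict E x).support ⊆ x.support := by
  classical
  rw [restrict, Finsupp.support_filter]
  exact Finset.filter_subset _ _

theorem mem_of_mem_support_restrict {E : Finset (Vec k)} {x : Vec k →₀ ℝ} {w : Vec k}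
    (hw : w ∈ (restrict E x).support) : w ∈ E ∧ w ∈ x.support := by
  classical
  rw [restrict, Finsupp.support_filter, Finset.mem_filter] at hw
  exact hw.symm

theorem restrict_eq_self {E : Finset (Vec k)} {x : Vec k →₀ ℝ} (h : ∀ w ∈ x.support, w ∈ E) :
    restrict E x = x := by
  classical
  ext w
  rw [restrict_apply]
  split_ifs with hw
  · rfl
  · by_contra hne
    exact hw (h w (Finsupp.mem_support_iff.2 (Ne.symm hne)))

theorem restrict_eq_zero {E : Finset (Vec k)} {x : Vec k →₀ ℝ} (h : ∀ w ∈ x.support, w ∉ E) :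
    restrict E x = 0 := by
  classical
  ext w
  rw [restrict_apply]
  split_ifs with hw
  · by_contra hne
    exact h w (Finsupp.mem_support_iff.2 hne) hw
  · rfl

/-- The `ℓ₁` norm of a finitely supported vector. -/
noncomputable def lOne (x : Vec k →₀ ℝ) : ℝ := ∑ w ∈ x.support, |x w|

theorem lOne_nonneg (x : Vec k →₀ ℝ) : 0 ≤ lOne x := Finset.sum_nonneg fun _ _ => abs_nonneg _

theorem abs_apply_le_lOne (x : Vec k →₀ ℝ) (w : Vec k) : |x w| ≤ lOne x := by
  by_cases hw : w ∈ x.support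
  · exact Finset.single_le_sum (f := fun w => |x w|) (fun _ _ => abs_nonneg _) hw
  · rw [Finsupp.notMem_support_iff.1 hw, abs_zero]
    exact lOne_nonneg x

theorem lOne_restrict (E : Finset (Vec k)) (x : Vec k →₀ ℝ) [DecidablePred (· ∈ E)] :
    lOne (restrict E x) = ∑ w ∈ x.support, if w ∈ E then |x w| else 0 := by
  rw [lOne, Finset.sum_subset (support_restrict_subset E x)]
  · refine Finset.sum_congr rfl fun w _ => ?_
    rw [restrict_apply]
    split_ifs <;> simp
  · intro w _ hw
    rw [Finsupp.notMem_support_iff.1 hw, abs_zero]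

theorem Admissible.sum_lOne_le {m : ℕ} {E : Fin m → Finset (Vec k)} (hE : Admissible k d E)
    (x : Vec k →₀ ℝ) : ∑ i, lOne (restrict (E i) x) ≤ lOne x := by
  classical
  simp only [lOne_restrict]
  rw [Finset.sum_comm]
  refine Finset.sum_le_sum fun w _ => ?_
  by_cases h : ∃ i, w ∈ E i
  · obtain ⟨i, hi⟩ := h
    rw [Finset.sum_eq_single i, if_pos hi]
    · intro j _ hj
      refine if_neg fun hw => ?_
      rcases lt_or_gt_of_ne hj with hlt | hlt
      · exact prec_irrefl _ (hE.2.2 _ _ hlt w hw w hi)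
      · exact prec_irrefl _ (hE.2.2 _ _ hlt w hi w hw)
    · simp
  · push Not at h
    simp [h]

theorem abs_apply_le_normSeq_zero (x : Vec k →₀ ℝ) (w : Vec k) : |x w| ≤ normSeq k d θ 0 x :=
  le_ciSup (f := fun w => |x w|) ⟨lOne x, by rintro _ ⟨w, rfl⟩; exact abs_apply_le_lOne x w⟩ w

theorem normSeq_nonneg (j : ℕ) (x : Vec k →₀ ℝ) : 0 ≤ normSeq k d θ j x := by
  induction j with
  | zero => exact Real.iSup_nonneg fun _ => abs_nonneg _
  | succ j ih => exact le_max_of_le_left ih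

theorem normSeq_succ_le {j : ℕ} {x : Vec k →₀ ℝ} {C : ℝ} (h : normSeq k d θ j x ≤ C)
    (hC : ∀ (m : ℕ) (E : Fin m → Finset (Vec k)), Admissible k d E →
      θ * ∑ i, normSeq k d θ j (restrict (E i) x) ≤ C) : normSeq k d θ (j + 1) x ≤ C := by
  refine max_le h (Real.sSup_le ?_ ((normSeq_nonneg j x).trans h))
  rintro _ ⟨m, -, E, hE, rfl⟩
  exact hC m E hE

theorem normSeq_le_lOne (hθ0 : 0 < θ) (hθ1 : θ < 1) (j : ℕ) (x : Vec k →₀ ℝ) :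
    normSeq k d θ j x ≤ lOne x := by
  induction j generalizing x with
  | zero => exact Real.iSup_le (abs_apply_le_lOne x) (lOne_nonneg x)
  | succ j ih =>
    refine normSeq_succ_le (ih x) fun m E hE => ?_
    calc θ * ∑ i, normSeq k d θ j (restrict (E i) x)
        ≤ θ * lOne x := by
          gcongr
          exact (Finset.sum_le_sum fun i _ => ih _).trans (hE.sum_lOne_le x)
      _ ≤ lOne x := mul_le_of_le_one_left (lOne_nonneg x) hθ1.le

theorem normSeq_monotone (x : Vec k →₀ ℝ) : Monotone fun j => normSeq k d θ j x :=
  monotone_nat_of_le_succ fun _ => le_max_left _ _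

theorem Admissible.le_normSeq_succ (hθ0 : 0 < θ) (hθ1 : θ < 1) {m : ℕ}
    {E : Fin m → Finset (Vec k)} (hE : Admissible k d E) (j : ℕ) (x : Vec k →₀ ℝ) :
    θ * ∑ i, normSeq k d θ j (restrict (E i) x) ≤ normSeq k d θ (j + 1) x := by
  rcases Nat.eq_zero_or_pos m with rfl | hm
  · simpa using normSeq_nonneg (j + 1) x
  refine le_max_of_le_right (le_csSup ⟨lOne x, ?_⟩ ⟨m, hm, E, hE, rfl⟩)
  rintro _ ⟨m, -, E, hE, rfl⟩
  calc θ * ∑ i, normSeq k d θ j (restrict (E i) x)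
      ≤ θ * lOne x := by
        gcongr
        exact (Finset.sum_le_sum fun i _ => normSeq_le_lOne hθ0 hθ1 j _).trans (hE.sum_lOne_le x)
    _ ≤ lOne x := mul_le_of_le_one_left (lOne_nonneg x) hθ1.le

theorem normSeq_add_le (hθ0 : 0 < θ) (hθ1 : θ < 1) (j : ℕ) (x y : Vec k →₀ ℝ) :
    normSeq k d θ j (x + y) ≤ normSeq k d θ j x + normSeq k d θ j y := by
  induction j generalizing x y with
  | zero =>
    refine Real.iSup_le (fun w => ?_) (add_nonneg (normSeq_nonneg 0 x) (normSeq_nonneg 0 y))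
    exact (abs_add_le _ _).trans
      (add_le_add (abs_apply_le_normSeq_zero x w) (abs_apply_le_normSeq_zero y w))
  | succ j ih =>
    refine normSeq_succ_le ((ih x y).trans (add_le_add (le_max_left _ _) (le_max_left _ _)))
      fun m E hE => ?_
    calc θ * ∑ i, normSeq k d θ j (restrict (E i) (x + y))
        ≤ θ * ∑ i, (normSeq k d θ j (restrict (E i) x) + normSeq k d θ j (restrict (E i) y)) := by
          gcongr with i
          rw [restrict_add]
          exact ih _ _
      _ ≤ _ := by
          rw [Finset.sum_add_distrib, mul_add]
          exact add_le_add (hE.le_normSeq_succ hθ0 hθ1 j x) (hE.le_normSeq_succ hθ0 hθ1 j y)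

theorem normSeq_zero_right (hθ0 : 0 < θ) (hθ1 : θ < 1) (j : ℕ) :
    normSeq k d θ j (0 : Vec k →₀ ℝ) = 0 :=
  le_antisymm ((normSeq_le_lOne hθ0 hθ1 j 0).trans (by simp [lOne])) (normSeq_nonneg j 0)

theorem normSeq_sum_le (hθ0 : 0 < θ) (hθ1 : θ < 1) (j : ℕ) {ι : Type*} (s : Finset ι)
    (x : ι → Vec k →₀ ℝ) :
    normSeq k d θ j (∑ i ∈ s, x i) ≤ ∑ i ∈ s, normSeq k d θ j (x i) :=
  Finset.le_sum_of_subadditive _ (normSeq_zero_right hθ0 hθ1 j).le (normSeq_add_le hθ0 hθ1 j) s x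

theorem normSeq_smul_le (hθ0 : 0 < θ) (hθ1 : θ < 1) (j : ℕ) (c : ℝ) (x : Vec k →₀ ℝ) :
    normSeq k d θ j (c • x) ≤ |c| * normSeq k d θ j x := by
  induction j generalizing x with
  | zero =>
    refine Real.iSup_le (fun w => ?_) (mul_nonneg (abs_nonneg c) (normSeq_nonneg 0 x))
    rw [Finsupp.smul_apply, smul_eq_mul, abs_mul]
    exact mul_le_mul_of_nonneg_left (abs_apply_le_normSeq_zero x w) (abs_nonneg c)
  | succ j ih =>
    refine normSeq_succ_le ((ih x).trans
      (mul_le_mul_of_nonneg_left (le_max_left _ _) (abs_nonneg c))) fun m E hE => ?_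
    calc θ * ∑ i, normSeq k d θ j (restrict (E i) (c • x))
        ≤ θ * ∑ i, |c| * normSeq k d θ j (restrict (E i) x) := by
          gcongr with i
          rw [restrict_smul]
          exact ih _
      _ = |c| * (θ * ∑ i, normSeq k d θ j (restrict (E i) x)) := by
          rw [← Finset.mul_sum]
          ring
      _ ≤ _ := mul_le_mul_of_nonneg_left (hE.le_normSeq_succ hθ0 hθ1 j x) (abs_nonneg c)

theorem normSeq_restrict_le (hθ0 : 0 < θ) (hθ1 : θ < 1) (j : ℕ) (F : Finset (Vec k))
    (x : Vec k →₀ ℝ) : normSeq k d θ j (restrict F x) ≤ normSeq k d θ j x := by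
  classical
  induction j generalizing x with
  | zero =>
    refine Real.iSup_le (fun w => ?_) (normSeq_nonneg 0 x)
    rw [restrict_apply]
    split_ifs
    · exact abs_apply_le_normSeq_zero x w
    · simpa using normSeq_nonneg 0 x
  | succ j ih =>
    refine normSeq_succ_le ((ih x).trans (le_max_left _ _)) fun m E hE => ?_
    refine le_trans ?_ (hE.le_normSeq_succ hθ0 hθ1 j x)
    gcongr with i
    rw [restrict_comm]
    exact ih _

theorem normSeq_le_tnorm (hθ0 : 0 < θ) (hθ1 : θ < 1) (j : ℕ) (x : Vec k →₀ ℝ) :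
    normSeq k d θ j x ≤ tnorm k d θ x :=
  le_ciSup (f := fun j => normSeq k d θ j x)
    ⟨lOne x, by rintro _ ⟨j, rfl⟩; exact normSeq_le_lOne hθ0 hθ1 j x⟩ j

theorem tendsto_normSeq (hθ0 : 0 < θ) (hθ1 : θ < 1) (x : Vec k →₀ ℝ) :
    Filter.Tendsto (fun j => normSeq k d θ j x) Filter.atTop (nhds (tnorm k d θ x)) :=
  tendsto_atTop_ciSup (normSeq_monotone x)
    ⟨lOne x, by rintro _ ⟨j, rfl⟩; exact normSeq_le_lOne hθ0 hθ1 j x⟩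

theorem tnorm_nonneg (x : Vec k →₀ ℝ) : 0 ≤ tnorm k d θ x :=
  Real.iSup_nonneg fun j => normSeq_nonneg j x

theorem tnorm_le {x : Vec k →₀ ℝ} {C : ℝ} (h : ∀ j, normSeq k d θ j x ≤ C) :
    tnorm k d θ x ≤ C := ciSup_le h

theorem tnorm_zero (hθ0 : 0 < θ) (hθ1 : θ < 1) : tnorm k d θ (0 : Vec k →₀ ℝ) = 0 :=
  le_antisymm (tnorm_le fun j => (normSeq_zero_right hθ0 hθ1 j).le) (tnorm_nonneg 0)

theorem tnorm_restrict_le (hθ0 : 0 < θ) (hθ1 : θ < 1) (F : Finset (Vec k)) (x : Vec k →₀ ℝ) :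
    tnorm k d θ (restrict F x) ≤ tnorm k d θ x :=
  tnorm_le fun j => (normSeq_restrict_le hθ0 hθ1 j F x).trans (normSeq_le_tnorm hθ0 hθ1 j x)

theorem tnorm_smul_le (hθ0 : 0 < θ) (hθ1 : θ < 1) (c : ℝ) (x : Vec k →₀ ℝ) :
    tnorm k d θ (c • x) ≤ |c| * tnorm k d θ x :=
  tnorm_le fun j => (normSeq_smul_le hθ0 hθ1 j c x).trans
    (mul_le_mul_of_nonneg_left (normSeq_le_tnorm hθ0 hθ1 j x) (abs_nonneg c))

theorem tnorm_smul (hθ0 : 0 < θ) (hθ1 : θ < 1) (c : ℝ) (x : Vec k →₀ ℝ) :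
    tnorm k d θ (c • x) = |c| * tnorm k d θ x := by
  refine le_antisymm (tnorm_smul_le hθ0 hθ1 c x) ?_
  rcases eq_or_ne c 0 with rfl | hc
  · simpa using tnorm_nonneg _
  · have h := tnorm_smul_le (d := d) hθ0 hθ1 c⁻¹ (c • x)
    rw [smul_smul, inv_mul_cancel₀ hc, one_smul, abs_inv] at h
    rwa [← le_inv_mul_iff₀ (abs_pos.2 hc)]

theorem Admissible.le_tnorm (hθ0 : 0 < θ) (hθ1 : θ < 1) {m : ℕ}
    {E : Fin m → Finset (Vec k)} (hE : Admissible k d E) (x : Vec k →₀ ℝ) :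
    θ * ∑ i, tnorm k d θ (restrict (E i) x) ≤ tnorm k d θ x :=
  le_of_tendsto' ((tendsto_finsetSum _ fun _ _ => tendsto_normSeq hθ0 hθ1 _).const_mul θ)
    fun j => (hE.le_normSeq_succ hθ0 hθ1 j x).trans (normSeq_le_tnorm hθ0 hθ1 _ x)

end Norm

section Tree

theorem nonDec_iff_getElem {l : List ℕ} :
    NonDec l ↔ ∀ i j (_hi : i < l.length) (_hj : j < l.length), i < j → l[i] ≤ l[j] :=
  List.isChain_iff_pairwise.trans List.pairwise_iff_getElem

theorem NonDec.getElem_le {l : List ℕ} (hl : NonDec l) {i j : ℕ} (hj : j < l.length)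
    (hij : i ≤ j) : l[i] ≤ l[j] := by
  rcases hij.eq_or_lt with rfl | h
  · exact le_rfl
  · exact nonDec_iff_getElem.1 hl i j (by omega) hj h

theorem getLast!_eq_getElem {l : List ℕ} (h : l ≠ []) :
    l.getLast! = l[l.length - 1]'(by have := List.length_pos_iff.2 h; omega) := by
  rw [List.getLast!_of_getLast? (List.getLast?_eq_some_getLast h), List.getLast_eq_getElem]

theorem NonDec.getElem_le_getLast! {l : List ℕ} (hl : NonDec l) {i : ℕ} (hi : i < l.length) :
    l[i] ≤ l.getLast! := by
  rw [getLast!_eq_getElem (List.ne_nil_of_length_pos (by omega))]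
  exact hl.getElem_le _ (by omega)

theorem length_Xhat {v s : List ℕ} (h : s.length ≤ v.length) : (Xhat v s).length = s.length := by
  simp only [Xhat, List.length_zipWith, List.length_take]
  omega

theorem getElem_Xhat {v s : List ℕ} (h : s.length ≤ v.length) {i : ℕ} (hi : i < s.length) :
    (Xhat v s)[i]'(by rwa [length_Xhat h]) =
      if s[i] = 0 then v[i] else v.getLast! + s[i] := by
  simp [Xhat]

theorem nonDec_Xhat {v s : List ℕ} (hv : NonDec v) (hs : NonDec s) (h : s.length ≤ v.length) :
    NonDec (Xhat v s) := by
  rw [nonDec_iff_getElem]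
  intro i j hi hj hij
  rw [length_Xhat h] at hi hj
  rw [getElem_Xhat h hi, getElem_Xhat h hj]
  have h1 := hs.getElem_le hj hij.le
  have h2 := hv.getElem_le (h.trans_lt' hj) hij.le
  have h3 := hv.getElem_le_getLast! (h.trans_lt' hi)
  split_ifs <;> omega

theorem Xhat_ne_nil {v s : List ℕ} (h : s.length ≤ v.length) (hs : s ≠ []) : Xhat v s ≠ [] := by
  rw [← List.length_pos_iff] at hs ⊢
  rwa [length_Xhat h]

theorem getLast!_Xhat {v s : List ℕ} (h : s.length ≤ v.length) (hs : s ≠ []) :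
    (Xhat v s).getLast! = if s.getLast! = 0 then v[s.length - 1]'(by
      have := List.length_pos_iff.2 hs; omega) else v.getLast! + s.getLast! := by
  have hpos := List.length_pos_iff.2 hs
  simp only [getLast!_eq_getElem (Xhat_ne_nil h hs), getLast!_eq_getElem hs, length_Xhat h]
  exact getElem_Xhat h (by omega)

theorem Xhat_prefix {v s t : List ℕ} (ht : t.length ≤ v.length) (hst : s <+: t) :
    Xhat v s <+: Xhat v t := by
  have hs := hst.length_le.trans ht
  rw [List.prefix_iff_getElem] at hst ⊢
  obtain ⟨hle, hst⟩ := hst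
  refine ⟨by rwa [length_Xhat hs, length_Xhat ht], fun i hi => ?_⟩
  rw [length_Xhat hs] at hi
  rw [getElem_Xhat hs hi, getElem_Xhat ht (by omega), hst i hi]

theorem Xhat_lt {v s t : List ℕ} (hv : NonDec v) (hs : s.length ≤ v.length)
    (ht : t.length ≤ v.length) (hst : s < t) : Xhat v s < Xhat v t := by
  rw [List.lt_iff_exists] at hst ⊢
  rcases hst with ⟨h, hlt⟩ | ⟨i, h1, h2, heq, hlt⟩
  · left
    rw [length_Xhat hs, length_Xhat ht]
    refine ⟨?_, hlt⟩
    have hp : s <+: t := h ▸ List.take_prefix _ _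
    have := List.prefix_iff_eq_take.1 (Xhat_prefix ht hp)
    rwa [length_Xhat hs] at this
  · right
    refine ⟨i, by rwa [length_Xhat hs], by rwa [length_Xhat ht], fun j hj => ?_, ?_⟩
    · rw [getElem_Xhat hs (by omega), getElem_Xhat ht (by omega), heq j hj]
    · rw [getElem_Xhat hs h1, getElem_Xhat ht h2]
      have := hv.getElem_le_getLast! (hs.trans_lt' h1)
      split_ifs <;> omega

theorem Xhat_prec {v s t : List ℕ} (hv : NonDec v) (ht' : NonDec t)
    (hs : s.length ≤ v.length) (ht : t.length ≤ v.length) (hst : prec s t) :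
    prec (Xhat v s) (Xhat v t) := by
  rcases hst with ⟨rfl, htn⟩ | ⟨hsn, htn, hst⟩
  · exact Or.inl ⟨by simp [Xhat], Xhat_ne_nil ht htn⟩
  refine Or.inr ⟨Xhat_ne_nil hs hsn, Xhat_ne_nil ht htn, ?_⟩
  have hsp := List.length_pos_iff.2 hsn
  have htp := List.length_pos_iff.2 htn
  rw [getLast!_Xhat hs hsn, getLast!_Xhat ht htn]
  have hv1 := hv.getElem_le_getLast! (i := s.length - 1) (by omega)
  have hv2 := hv.getElem_le_getLast! (i := t.length - 1) (by omega)
  rcases hst with hlt | ⟨heq, hlex⟩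
  · left
    split_ifs <;> omega
  · by_cases h0 : t.getLast! = 0
    · rw [if_pos (heq.trans h0), if_pos h0]
      have hlen : s.length ≤ t.length := by
        have hlex' : s < t := hlex
        rw [List.lt_iff_exists] at hlex'
        rcases hlex' with ⟨-, h⟩ | ⟨i, h1, h2, -, hlt⟩
        · exact h.le
        · have := ht'.getElem_le_getLast! h2
          omega
      have := hv.getElem_le (i := s.length - 1) (j := t.length - 1) (by omega) (by omega)
      rcases this.lt_or_eq with h | h
      · exact Or.inl h
      · exact Or.inr ⟨h, Xhat_lt hv hs ht hlex⟩
    · right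
      rw [heq, if_neg h0, if_neg h0]
      exact ⟨rfl, Xhat_lt hv hs ht hlex⟩

theorem isEkTree_Xhat {k : ℕ} (v : Vec k) : IsEkTree k (Xhat v.1) := by
  refine ⟨fun s hs hk => ?_, fun s t _ ht hsk htk => ?_⟩
  · exact ⟨nonDec_Xhat v.2.1 hs (by rwa [v.2.2]), length_Xhat (by rwa [v.2.2])⟩
  · exact ⟨Xhat_prec v.2.1 ht (by rwa [v.2.2]) (by rwa [v.2.2]),
      Xhat_prefix (by rwa [v.2.2])⟩

theorem eq_or_prec_Xhat {v s : List ℕ} (hs : NonDec s) (hlen : s.length = v.length) :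
    Xhat v s = v ∨ prec v (Xhat v s) := by
  by_cases hsn : s = []
  · subst hsn
    left
    rw [List.eq_nil_of_length_eq_zero hlen.symm]
    simp [Xhat]
  by_cases h0 : s.getLast! = 0
  · left
    refine List.ext_getElem (by rw [length_Xhat hlen.le, hlen]) fun i h1 h2 => ?_
    have := hs.getElem_le_getLast! (hlen ▸ h2)
    rw [getElem_Xhat hlen.le (hlen ▸ h2), if_pos (by omega)]
  · right
    refine Or.inr ⟨List.ne_nil_of_length_pos (hlen ▸ List.length_pos_iff.2 hsn),
      Xhat_ne_nil hlen.le hsn, Or.inl ?_⟩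
    rw [getLast!_Xhat hlen.le hsn, if_neg h0]
    omega

/-- Coordinatewise description of `XmaxSet v`. -/
def XmaxRel (v w : List ℕ) : Prop :=
  w.length = v.length ∧ NonDec w ∧
    ∀ i (_ : i < v.length) (_ : i < w.length), w[i] = v[i] ∨ v.getLast! < w[i]

theorem XmaxRel.of_mem {v w : List ℕ} (h : w ∈ XmaxSet v) : XmaxRel v w := by
  obtain ⟨hlen, hw, h⟩ := h
  refine ⟨hlen, hw, fun i hiv hiw => ?_⟩
  rcases h with h | ⟨j, -, hj, heq, h⟩
  · right
    refine h.trans_le ?_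
    have : w.headI = w[0] := by
      cases w with
      | nil => simp at hiw
      | cons a l => rfl
    rw [this]
    exact hw.getElem_le hiw (Nat.zero_le i)
  · by_cases hij : i < j
    · left
      have h1 : (w.take j)[i]'(by simp; omega) = (v.take j)[i]'(by simp; omega) := by
        simp only [heq]
      simpa using h1
    · right
      have h2 := h (by omega)
      rw [List.getD_eq_getElem _ _ (by omega)] at h2
      exact h2.trans_le (hw.getElem_le hiw (by omega))

theorem XmaxRel.refl {v : List ℕ} (hv : NonDec v) : XmaxRel v v :=
  ⟨rfl, hv, fun _ _ _ => Or.inl rfl⟩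

theorem XmaxRel.getLast!_le {v w : List ℕ} (h : XmaxRel v w) : v.getLast! ≤ w.getLast! := by
  by_cases hv : v = []
  · subst hv
    rw [List.eq_nil_of_length_eq_zero h.1]
  · have hw : w ≠ [] := List.ne_nil_of_length_pos (h.1 ▸ List.length_pos_iff.2 hv)
    have hpos := List.length_pos_iff.2 hv
    have hlen := h.1
    rw [getLast!_eq_getElem hw]
    rcases h.2.2 (w.length - 1) (by omega) (by omega) with h | h
    · rw [h, getLast!_eq_getElem hv]
      simp only [hlen, le_refl]
    · exact h.le

theorem XmaxRel.trans {u v w : List ℕ} (h : XmaxRel u v) (h' : XmaxRel v w) : XmaxRel u w := by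
  refine ⟨h'.1.trans h.1, h'.2.1, fun i hu hw => ?_⟩
  have hv : i < v.length := by rwa [h.1]
  rcases h'.2.2 i hv hw with h2 | h2
  · rw [h2]
    exact h.2.2 i hu hv
  · exact Or.inr (h.getLast!_le.trans_lt h2)

theorem XmaxRel.exists_eq_Xhat {v w : List ℕ} (hv : NonDec v) (h : XmaxRel v w) :
    ∃ s, NonDec s ∧ s.length = v.length ∧ w = Xhat v s := by
  have hlen : (w.map (· - v.getLast!)).length = v.length := by rw [List.length_map, h.1]
  refine ⟨w.map (· - v.getLast!), ?_, hlen, ?_⟩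
  · rw [nonDec_iff_getElem]
    intro i j hi hj hij
    rw [List.length_map] at hi hj
    have := h.2.1.getElem_le hj hij.le
    simp only [List.getElem_map]
    omega
  · refine List.ext_getElem (by rw [length_Xhat hlen.le, List.length_map]) fun i h1 h2 => ?_
    have hiv : i < v.length := h.1 ▸ h1
    rw [getElem_Xhat hlen.le (by rwa [hlen]), List.getElem_map]
    have := hv.getElem_le_getLast! hiv
    rcases h.2.2 i hiv h1 with h | h
    · rw [if_pos (by omega), h]
    · rw [if_neg (by omega)]
      omega

theorem finite_setOf_prec {k : ℕ} (u : List ℕ) : {w : Vec k | prec w.1 u}.Finite := by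
  refine Set.Finite.of_finite_image (f := fun w : Vec k => fun i : Fin k =>
    w.1[i.1]'(by rw [w.2.2]; exact i.2)) ?_ ?_
  · refine (Set.finite_Iic (fun _ : Fin k => u.getLast!)).subset ?_
    rintro _ ⟨w, hw, rfl⟩ i
    have h1 := w.2.1.getElem_le_getLast! (i := i.1) (by rw [w.2.2]; exact i.2)
    rcases hw with ⟨h, -⟩ | ⟨-, -, h | ⟨h, -⟩⟩
    · have hw2 : w.1.length = k := w.2.2
      rw [h, List.length_nil] at hw2
      exact absurd i.2 (by omega)
    · exact h1.trans h.le
    · exact h1.trans h.le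
  · intro w _ w' _ heq
    refine Subtype.ext (List.ext_getElem (by rw [w.2.2, w'.2.2]) fun i hi _ => ?_)
    exact congrFun heq ⟨i, by rwa [w.2.2] at hi⟩

/-- The elements of the maximal member of the Ellentuck space with minimum `v` that are
`≺`-below `u`. -/
noncomputable def initialSegment {k : ℕ} (v u : Vec k) : Finset (Vec k) :=
  ((finite_setOf_prec u.1).inter_of_left
    {w : Vec k | ∃ s, NonDec s ∧ s.length = k ∧ w.1 = Xhat v.1 s}).toFinset

theorem mem_initialSegment {k : ℕ} {v u w : Vec k} : w ∈ initialSegment v u ↔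
    prec w.1 u.1 ∧ ∃ s, NonDec s ∧ s.length = k ∧ w.1 = Xhat v.1 s := by
  simp [initialSegment]

theorem memARV_initialSegment {k : ℕ} (v u : Vec k) : memARV k (initialSegment v u) := by
  refine ⟨Xhat v.1, isEkTree_Xhat v, ?_, ?_⟩
  · intro e he
    obtain ⟨w, hw, rfl⟩ := Finset.mem_image.1 he
    exact (mem_initialSegment.1 hw).2
  · intro s hs hk e he hse
    obtain ⟨w, hw, rfl⟩ := Finset.mem_image.1 he
    have h := (isEkTree_Xhat v).1 s hs hk.le
    exact Finset.mem_image.2 ⟨⟨Xhat v.1 s, h.1, h.2.trans hk⟩, mem_initialSegment.2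
      ⟨prec_trans hse (mem_initialSegment.1 hw).1, s, hs, hk, rfl⟩, rfl⟩

theorem memARV_empty (k : ℕ) : memARV k ∅ :=
  ⟨id, ⟨fun _ hs _ => ⟨hs, rfl⟩, fun _ _ _ _ _ _ => ⟨id, id⟩⟩, by simp, by simp⟩

theorem eq_or_prec_of_mem_initialSegment {k : ℕ} {v u w : Vec k}
    (hw : w ∈ initialSegment v u) : v = w ∨ prec v.1 w.1 := by
  obtain ⟨s, hs, hk, h⟩ := (mem_initialSegment.1 hw).2
  rw [Subtype.ext_iff, h, eq_comm]
  exact eq_or_prec_Xhat hs (hk.trans v.2.2.symm)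

end Tree

section Blocks

variable {k d : ℕ} {θ : ℝ} {x : ℕ → (Vec k →₀ ℝ)} {v : ℕ → Vec k}

theorem markers_strictMono (hx : ∀ i, x i ≠ 0)
    (h1 : ∀ i, ∀ w ∈ (x i).support, (v i = w ∨ prec (v i).1 w.1) ∧ prec w.1 (v (i + 1)).1)
    {i j : ℕ} (hij : i < j) : prec (v i).1 (v j).1 := by
  induction j, hij using Nat.le_induction with
  | base =>
    obtain ⟨w, hw⟩ := Finsupp.support_nonempty_iff.2 (hx i)
    obtain ⟨rfl | h, h'⟩ := h1 i w hw
    · exact h'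
    · exact prec_trans h h'
  | succ j _ ih =>
    obtain ⟨w, hw⟩ := Finsupp.support_nonempty_iff.2 (hx j)
    obtain ⟨rfl | h, h'⟩ := h1 j w hw
    · exact prec_trans ih h'
    · exact prec_trans ih (prec_trans h h')

theorem markers_xmaxRel (h3 : ∀ i, (v (i + 1)).1 ∈ XmaxSet (v i).1) {i j : ℕ} (hij : i ≤ j) :
    XmaxRel (v i).1 (v j).1 := by
  induction j, hij using Nat.le_induction with
  | base => exact XmaxRel.refl (v i).2.1
  | succ j _ ih => exact ih.trans (XmaxRel.of_mem (h3 j))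

/-- A set of `AR^k` picking out the blocks whose index lies between two members of `s`. -/
noncomputable def hullSet (v : ℕ → Vec k) (s : Finset ℕ) : Finset (Vec k) :=
  if h : s.Nonempty then initialSegment (v (s.min' h)) (v (s.max' h + 1)) else ∅

theorem memARV_hullSet (s : Finset ℕ) : memARV k (hullSet v s) := by
  unfold hullSet
  split_ifs
  · exact memARV_initialSegment _ _
  · exact memARV_empty k

theorem restrict_hullSet_of_mem
    (h1 : ∀ i, ∀ w ∈ (x i).support, (v i = w ∨ prec (v i).1 w.1) ∧ prec w.1 (v (i + 1)).1)
    (h2 : ∀ i, ∀ w ∈ (x i).support, w.1 ∈ XmaxSet (v i).1)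
    (h3 : ∀ i, (v (i + 1)).1 ∈ XmaxSet (v i).1) (hx : ∀ i, x i ≠ 0)
    {s : Finset ℕ} {i : ℕ} (hi : i ∈ s) : restrict (hullSet v s) (x i) = x i := by
  refine restrict_eq_self fun w hw => ?_
  rw [hullSet, dif_pos ⟨i, hi⟩, mem_initialSegment]
  constructor
  · rcases (s.le_max' i hi).eq_or_lt with h | h
    · rw [← h]
      exact (h1 i w hw).2
    · exact prec_trans (h1 i w hw).2 (markers_strictMono hx h1 (Nat.succ_lt_succ h))
  · obtain ⟨t, ht, hlen, h⟩ := ((markers_xmaxRel h3 (s.min'_le i hi)).trans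
      (XmaxRel.of_mem (h2 i w hw))).exists_eq_Xhat (v _).2.1
    exact ⟨t, ht, hlen.trans (v _).2.2, h⟩

theorem restrict_hullSet_of_lt
    (h1 : ∀ i, ∀ w ∈ (x i).support, (v i = w ∨ prec (v i).1 w.1) ∧ prec w.1 (v (i + 1)).1)
    (hx : ∀ i, x i ≠ 0) {s : Finset ℕ} {i : ℕ} (hi : ∀ j ∈ s, i < j) :
    restrict (hullSet v s) (x i) = 0 := by
  refine restrict_eq_zero fun w hw hws => ?_
  unfold hullSet at hws
  split_ifs at hws with hs
  · have hlt : prec w.1 (v (s.min' hs)).1 := by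
      rcases (Nat.succ_le_of_lt (hi _ (s.min'_mem hs))).eq_or_lt with h | h
      · exact h ▸ (h1 i w hw).2
      · exact prec_trans (h1 i w hw).2 (markers_strictMono hx h1 h)
    rcases eq_or_prec_of_mem_initialSegment hws with h | h
    · exact prec_irrefl _ (h ▸ hlt)
    · exact prec_asymm h hlt
  · exact absurd hws (Finset.notMem_empty _)

theorem restrict_hullSet_of_gt
    (h1 : ∀ i, ∀ w ∈ (x i).support, (v i = w ∨ prec (v i).1 w.1) ∧ prec w.1 (v (i + 1)).1)
    (hx : ∀ i, x i ≠ 0) {s : Finset ℕ} {i : ℕ} (hi : ∀ j ∈ s, j < i) :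
    restrict (hullSet v s) (x i) = 0 := by
  refine restrict_eq_zero fun w hw hws => ?_
  unfold hullSet at hws
  split_ifs at hws with hs
  · have hlt := (mem_initialSegment.1 hws).1
    have hlt' : prec w.1 (v i).1 := by
      rcases (Nat.succ_le_of_lt (hi _ (s.max'_mem hs))).eq_or_lt with h | h
      · exact h ▸ hlt
      · exact prec_trans hlt (markers_strictMono hx h1 h)
    rcases (h1 i w hw).1 with h | h
    · exact prec_irrefl _ (h ▸ hlt')
    · exact prec_asymm h hlt'
  · exact absurd hws (Finset.notMem_empty _)

theorem successive_hullSet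
    (h1 : ∀ i, ∀ w ∈ (x i).support, (v i = w ∨ prec (v i).1 w.1) ∧ prec w.1 (v (i + 1)).1)
    (hx : ∀ i, x i ≠ 0) {s t : Finset ℕ} (hst : ∀ i ∈ s, ∀ j ∈ t, i < j) :
    Successive (hullSet v s) (hullSet v t) := by
  intro a ha b hb
  unfold hullSet at ha hb
  split_ifs at ha hb with hs ht
  · have hlt : prec a.1 (v (t.min' ht)).1 := by
      rcases (Nat.succ_le_of_lt (hst _ (s.max'_mem hs) _ (t.min'_mem ht))).eq_or_lt with h | h
      · exact h ▸ (mem_initialSegment.1 ha).1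
      · exact prec_trans (mem_initialSegment.1 ha).1 (markers_strictMono hx h1 h)
    rcases eq_or_prec_of_mem_initialSegment hb with h | h
    · exact h ▸ hlt
    · exact prec_trans hlt h
  · exact absurd hb (Finset.notMem_empty _)
  · exact absurd ha (Finset.notMem_empty _)
  · exact absurd ha (Finset.notMem_empty _)

/-- Norms of sums of blocks are superadditive, up to the factor `θ`, over `d` successive sets of
indices. -/
theorem mul_sum_tnorm_le (hθ0 : 0 < θ) (hθ1 : θ < 1)
    (h1 : ∀ i, ∀ w ∈ (x i).support, (v i = w ∨ prec (v i).1 w.1) ∧ prec w.1 (v (i + 1)).1)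
    (h2 : ∀ i, ∀ w ∈ (x i).support, w.1 ∈ XmaxSet (v i).1)
    (h3 : ∀ i, (v (i + 1)).1 ∈ XmaxSet (v i).1) (hx : ∀ i, x i ≠ 0) (a : ℕ → ℝ)
    (s : Fin d → Finset ℕ) (hs : ∀ e e', e < e' → ∀ i ∈ s e, ∀ j ∈ s e', i < j) :
    θ * ∑ e, tnorm k d θ (∑ i ∈ s e, a i • x i) ≤
      tnorm k d θ (∑ i ∈ Finset.univ.biUnion s, a i • x i) := by
  have hE : Admissible k d fun e => hullSet v (s e) :=
    ⟨le_rfl, fun e => memARV_hullSet _, fun e e' h => successive_hullSet h1 hx (hs e e' h)⟩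
  refine le_of_eq_of_le ?_ (hE.le_tnorm hθ0 hθ1 _)
  refine congrArg (θ * ·) (Finset.sum_congr rfl fun e _ => congrArg _ ?_)
  rw [restrict_sum, ← Finset.sum_subset (Finset.subset_biUnion_of_mem s (Finset.mem_univ e))]
  · refine Finset.sum_congr rfl fun i hi => ?_
    rw [restrict_smul, restrict_hullSet_of_mem h1 h2 h3 hx hi]
  · intro i hi hie
    obtain ⟨e', -, hie'⟩ := Finset.mem_biUnion.1 hi
    rw [restrict_smul]
    rcases lt_trichotomy e e' with h | rfl | h
    · rw [restrict_hullSet_of_gt h1 hx fun j hj => hs e e' h j hj i hie', smul_zero]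
    · exact absurd hie' hie
    · rw [restrict_hullSet_of_lt h1 hx fun j hj => hs e' e h i hie' j hj, smul_zero]

end Blocks

section Lower

/-- Evaluation of a superadditive set function along a `d`-adic tree: the index `i` sits at depth
`n i`, in the `d`-adic interval containing `l i`. -/
theorem sum_pow_mul_le_of_tree {d : ℕ} (hd : 2 ≤ d) {θ : ℝ} (hθ0 : 0 < θ) {α : ℕ → ℝ}
    {g : Finset ℕ → ℝ} (hg0 : ∀ s, 0 ≤ g s) (hg1 : ∀ i, α i ≤ g {i})
    (hg : ∀ s : Fin d → Finset ℕ, (∀ e e', e < e' → ∀ i ∈ s e, ∀ j ∈ s e', i < j) →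
      θ * ∑ e, g (s e) ≤ g (Finset.univ.biUnion s))
    (S : Finset ℕ) (n : ℕ → ℕ) (l : ℕ → ℝ) (hl1 : ∀ i ∈ S, l i < 1)
    (hmono : ∀ i ∈ S, ∀ j ∈ S, l i < l j → i < j)
    (hleaf : ∀ i ∈ S, ∀ j ∈ S, ⌊l j * (d : ℝ) ^ n i⌋₊ = ⌊l i * (d : ℝ) ^ n i⌋₊ → j = i) :
    ∑ i ∈ S, θ ^ n i * α i ≤ g S := by
  have hd0 : (0 : ℝ) < d := by exact_mod_cast (by omega : 0 < d)
  set node : ℕ → ℕ → Finset ℕ := fun r t => S.filter fun i => r ≤ n i ∧ ⌊l i * (d : ℝ) ^ r⌋₊ = t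
    with hnode
  have key : ∀ m r t, (∀ i ∈ S, n i < r + m) →
      ∑ i ∈ node r t, θ ^ (n i - r) * α i ≤ g (node r t) := by
    intro m
    induction m with
    | zero =>
      intro r t h
      have : node r t = ∅ := Finset.filter_eq_empty_iff.2 fun i hi hri => by
        have := h i hi
        omega
      rw [this, Finset.sum_empty]
      exact hg0 _
    | succ m ih =>
      intro r t h
      by_cases hex : ∃ i ∈ node r t, n i = r
      · obtain ⟨i, hi, hir⟩ := hex
        have hi' := Finset.mem_filter.1 hi
        have : node r t = {i} := by
          refine Finset.eq_singleton_iff_unique_mem.2 ⟨hi, fun j hj => ?_⟩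
          have hj' := Finset.mem_filter.1 hj
          refine hleaf i hi'.1 j hj'.1 ?_
          rw [hir, hj'.2.2, hi'.2.2]
        rw [this, Finset.sum_singleton, hir, Nat.sub_self, pow_zero, one_mul]
        exact hg1 i
      · push Not at hex
        have hfloor : ∀ i, ⌊l i * (d : ℝ) ^ r⌋₊ = ⌊l i * (d : ℝ) ^ (r + 1)⌋₊ / d := by
          intro i
          rw [← Nat.floor_div_natCast, pow_succ, ← mul_assoc, mul_div_cancel_right₀ _ hd0.ne']
        have hunion : node r t = Finset.univ.biUnion fun e : Fin d => node (r + 1) (d * t + e) := by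
          ext i
          simp only [Finset.mem_biUnion, Finset.mem_univ, true_and]
          constructor
          · intro hi
            have hi' := Finset.mem_filter.1 hi
            refine ⟨⟨⌊l i * (d : ℝ) ^ (r + 1)⌋₊ % d, Nat.mod_lt _ (by omega)⟩,
              Finset.mem_filter.2 ⟨hi'.1, ?_, ?_⟩⟩
            · exact Nat.lt_of_le_of_ne hi'.2.1 (hex i hi).symm
            · rw [← hi'.2.2, hfloor i, Nat.div_add_mod]
          · rintro ⟨e, hi⟩
            have hi' := Finset.mem_filter.1 hi
            refine Finset.mem_filter.2 ⟨hi'.1, by omega, ?_⟩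
            rw [hfloor i, hi'.2.2, Nat.mul_add_div (by omega), Nat.div_eq_of_lt e.2, add_zero]
        have hsucc : ∀ e e' : Fin d, e < e' → ∀ i ∈ node (r + 1) (d * t + e),
            ∀ j ∈ node (r + 1) (d * t + e'), i < j := by
          intro e e' hee i hi j hj
          have hi' := Finset.mem_filter.1 hi
          have hj' := Finset.mem_filter.1 hj
          refine hmono i hi'.1 j hj'.1 (lt_of_not_ge fun hle => ?_)
          have h4 : ⌊l j * (d : ℝ) ^ (r + 1)⌋₊ ≤ ⌊l i * (d : ℝ) ^ (r + 1)⌋₊ :=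
            Nat.floor_mono (by gcongr)
          have h5 : (e : ℕ) < e' := hee
          rw [hj'.2.2, hi'.2.2] at h4
          omega
        rw [hunion]
        refine le_trans ?_ (hg _ hsucc)
        rw [Finset.sum_biUnion, Finset.mul_sum]
        · refine Finset.sum_le_sum fun e _ => ?_
          refine le_of_eq_of_le ?_ (mul_le_mul_of_nonneg_left
            (ih (r + 1) (d * t + e) fun i hi => by have := h i hi; omega) hθ0.le)
          rw [Finset.mul_sum]
          refine Finset.sum_congr rfl fun i hi => ?_
          have hi' := Finset.mem_filter.1 hi
          rw [← mul_assoc, ← pow_succ']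
          congr 2
          omega
        · intro e _ e' _ hne
          refine Finset.disjoint_left.2 fun i hi hi' => ?_
          rcases lt_or_gt_of_ne hne with h | h
          · exact lt_irrefl _ (hsucc e e' h i hi i hi')
          · exact lt_irrefl _ (hsucc e' e h i hi' i hi)
  have hroot : node 0 0 = S := by
    refine Finset.filter_true_of_mem fun i hi => ⟨Nat.zero_le _, ?_⟩
    rw [pow_zero, mul_one, Nat.floor_eq_zero]
    exact hl1 i hi
  have := key (S.sup n + 1) 0 0 fun i hi => by
    have := Finset.le_sup (f := n) hi
    omega
  rw [hroot] at this
  simpa using this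

theorem lp_le_of_superadditive {d : ℕ} (hd : 2 ≤ d) {θ p : ℝ} (hθ0 : 0 < θ) (hp : 1 < p)
    (hdp : (d : ℝ) * θ = (d : ℝ) ^ (1 / p)) {α : ℕ → ℝ}
    {g : Finset ℕ → ℝ} (hg0 : ∀ s, 0 ≤ g s) (hg1 : ∀ i, α i ≤ g {i})
    (hg : ∀ s : Fin d → Finset ℕ, (∀ e e', e < e' → ∀ i ∈ s e, ∀ j ∈ s e', i < j) →
      θ * ∑ e, g (s e) ≤ g (Finset.univ.biUnion s))
    (S : Finset ℕ) (hα : ∀ i ∈ S, 0 < α i) :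
    1 / (2 * (d : ℝ)) * (∑ i ∈ S, α i ^ p) ^ (1 / p) ≤ g S := by
  have hd2 : (2 : ℝ) ≤ d := by exact_mod_cast hd
  have hd0 : (0 : ℝ) < d := by linarith
  rcases S.eq_empty_or_nonempty with rfl | hS
  · rw [Finset.sum_empty, Real.zero_rpow (by positivity), mul_zero]
    exact hg0 _
  set B := ∑ i ∈ S, α i ^ p with hB
  have hB0 : 0 < B := Finset.sum_pos (fun i hi => Real.rpow_pos_of_pos (hα i hi) p) hS
  set b : ℕ → ℝ := fun i => α i ^ p / B with hb
  have hb0 : ∀ i ∈ S, 0 < b i := fun i hi => div_pos (Real.rpow_pos_of_pos (hα i hi) p) hB0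
  have hbsum : ∑ i ∈ S, b i = 1 := by rw [← Finset.sum_div, div_self hB0.ne']
  have hb1 : ∀ i ∈ S, b i ≤ 1 := fun i hi =>
    hbsum ▸ Finset.single_le_sum (f := b) (fun j hj => (hb0 j hj).le) hi
  set c : ℕ → ℝ := fun i => ∑ j ∈ S with j < i, b j with hc
  have hc0 : ∀ i, 0 ≤ c i := fun i =>
    Finset.sum_nonneg fun j hj => (hb0 j (Finset.mem_filter.1 hj).1).le
  have hcb : ∀ i ∈ S, c i + b i = ∑ j ∈ S with j ≤ i, b j := by
    intro i hi
    have : S.filter (· ≤ i) = insert i (S.filter (· < i)) := by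
      ext j
      simp only [Finset.mem_filter, Finset.mem_insert, le_iff_lt_or_eq]
      constructor
      · rintro ⟨h, h' | h'⟩ <;> simp_all
      · rintro (rfl | h) <;> simp_all
    rw [this, Finset.sum_insert (by simp), add_comm]
  have hcc : ∀ i ∈ S, ∀ j, i < j → c i + b i ≤ c j := by
    intro i hi j hij
    rw [hcb i hi]
    refine Finset.sum_le_sum_of_subset_of_nonneg (fun m hm => ?_)
      fun m hm _ => (hb0 m (Finset.mem_filter.1 hm).1).le
    have hm' := Finset.mem_filter.1 hm
    exact Finset.mem_filter.2 ⟨hm'.1, hm'.2.trans_lt hij⟩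
  have hc1 : ∀ i ∈ S, c i + b i ≤ 1 := by
    intro i hi
    rw [hcb i hi, ← hbsum]
    exact Finset.sum_le_sum_of_subset_of_nonneg (Finset.filter_subset _ _)
      fun m hm _ => (hb0 m hm).le
  have hdepth : ∀ i ∈ S, ∃ n : ℕ, 2 < b i * (d : ℝ) ^ n ∧ b i * (d : ℝ) ^ n ≤ 2 * d := by
    intro i hi
    obtain ⟨n, hn1, hn2⟩ := exists_nat_pow_near_of_lt_one (x := b i / 2) (y := (d : ℝ)⁻¹)
      (by have := hb0 i hi; positivity) (by have := hb1 i hi; linarith) (inv_pos.2 hd0)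
      (inv_lt_one_of_one_lt₀ (by linarith))
    refine ⟨n + 1, ?_, ?_⟩
    · rw [inv_pow, inv_lt_iff_one_lt_mul₀ (by positivity)] at hn1
      linarith
    · rw [inv_pow, ← one_div, le_div_iff₀ (by positivity)] at hn2
      rw [pow_succ]
      nlinarith
  choose! n hn1 hn2 using hdepth
  set u : ℕ → ℕ := fun i => ⌈c i * (d : ℝ) ^ n i⌉₊ with hu
  set l : ℕ → ℝ := fun i => u i / (d : ℝ) ^ n i with hl
  have hpow : ∀ m : ℕ, (0 : ℝ) < (d : ℝ) ^ m := fun m => pow_pos hd0 m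
  have hlu : ∀ i, l i * (d : ℝ) ^ n i = u i := fun i => div_mul_cancel₀ _ (hpow _).ne'
  have huc : ∀ i, c i * (d : ℝ) ^ n i ≤ u i := fun i => Nat.le_ceil _
  have huc' : ∀ i, (u i : ℝ) < c i * (d : ℝ) ^ n i + 1 := fun i =>
    Nat.ceil_lt_add_one (mul_nonneg (hc0 i) (hpow _).le)
  have hcl : ∀ i, c i ≤ l i := fun i => (le_div_iff₀ (hpow _)).2 (huc i)
  have hlc : ∀ i ∈ S, l i < c i + b i := fun i hi => by
    rw [hl, div_lt_iff₀ (hpow _), add_mul]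
    linarith [huc' i, hn1 i hi]
  have hsep : ∀ i ∈ S, ∀ j ∈ S, ∀ z, c i ≤ z → z < c i + b i → c j ≤ z → z < c j + b j →
      j = i := by
    intro i hi j hj z h1 h2 h3 h4
    rcases lt_trichotomy i j with h | h | h
    · linarith [hcc i hi j h]
    · exact h.symm
    · linarith [hcc j hj i h]
  have htree := sum_pow_mul_le_of_tree hd hθ0 hg0 hg1 hg S n l
    (fun i hi => (hlc i hi).trans_le (hc1 i hi))
    (fun i hi j hj hij => by
      by_contra hle
      rcases (not_lt.1 hle).eq_or_lt with rfl | h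
      · exact lt_irrefl _ hij
      · linarith [hcc j hj i h, hcl i, hlc j hj])
    (fun i hi j hj hij => by
      rw [hlu, Nat.floor_natCast] at hij
      have h1 : (u i : ℝ) ≤ l j * (d : ℝ) ^ n i :=
        hij ▸ Nat.floor_le (mul_nonneg ((hc0 j).trans (hcl j)) (hpow _).le)
      have h2 : l j * (d : ℝ) ^ n i < u i + 1 := hij ▸ Nat.lt_floor_add_one _
      refine hsep i hi j hj (l j) ?_ ?_ (hcl j) (hlc j hj)
      · exact le_of_mul_le_mul_right ((huc i).trans h1) (hpow (n i))
      · refine lt_of_mul_lt_mul_right ?_ (hpow (n i)).le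
        rw [add_mul]
        linarith [huc' i, hn1 i hi])
  refine le_trans ?_ htree
  have hp0 : 0 < p := by linarith
  set q : ℝ := 1 - 1 / p with hq
  have hp1 : 1 / p < 1 := by rw [div_lt_one hp0]; exact hp
  have hp1' : 0 < 1 / p := by positivity
  have hθd : θ = (d : ℝ) ^ (-q) := by
    rw [hq, neg_sub, Real.rpow_sub hd0, Real.rpow_one, ← hdp]
    field_simp
  have hterm : ∀ i ∈ S, 1 / (2 * (d : ℝ)) * (B ^ (1 / p) * b i) ≤ θ ^ n i * α i := by
    intro i hi
    have hbi := hb0 i hi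
    have hαb : α i = B ^ (1 / p) * b i ^ (1 / p) := by
      rw [← Real.mul_rpow hB0.le hbi.le, hb, mul_div_cancel₀ _ hB0.ne', ← Real.rpow_mul (hα i hi).le,
        mul_one_div_cancel hp0.ne', Real.rpow_one]
    have hθn : θ ^ n i = ((d : ℝ) ^ n i) ^ (-q) := by
      rw [hθd, ← Real.rpow_natCast, ← Real.rpow_mul hd0.le, ← Real.rpow_natCast,
        ← Real.rpow_mul hd0.le, mul_comm]
    have hθb : 1 / (2 * (d : ℝ)) * b i ^ q ≤ θ ^ n i := by
      have h1 : (d : ℝ) ^ n i ≤ 2 * d / b i := by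
        rw [le_div_iff₀ hbi, mul_comm]
        exact hn2 i hi
      have h2 : (2 * d / b i) ^ (-q) ≤ ((d : ℝ) ^ n i) ^ (-q) :=
        Real.rpow_le_rpow_of_nonpos (hpow _) h1 (by linarith)
      rw [hθn]
      refine le_trans ?_ h2
      rw [Real.div_rpow (by positivity) hbi.le, Real.rpow_neg hbi.le, div_inv_eq_mul]
      gcongr
      rw [one_div, ← Real.rpow_neg_one]
      exact Real.rpow_le_rpow_of_exponent_le (by linarith) (by linarith)
    have hbb : b i = b i ^ q * b i ^ (1 / p) := by
      rw [← Real.rpow_add hbi, hq, sub_add_cancel, Real.rpow_one]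
    calc 1 / (2 * (d : ℝ)) * (B ^ (1 / p) * b i)
        = 1 / (2 * (d : ℝ)) * b i ^ q * (B ^ (1 / p) * b i ^ (1 / p)) := by
          conv_lhs => rw [hbb]
          ring
      _ ≤ θ ^ n i * (B ^ (1 / p) * b i ^ (1 / p)) := by gcongr
      _ = θ ^ n i * α i := by rw [← hαb]
  calc 1 / (2 * (d : ℝ)) * B ^ (1 / p)
      = ∑ i ∈ S, 1 / (2 * (d : ℝ)) * (B ^ (1 / p) * b i) := by
        rw [← Finset.mul_sum, ← Finset.mul_sum, hbsum, mul_one]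
    _ ≤ _ := Finset.sum_le_sum hterm

end Lower

section Upper

/-- The `ℓ_p` norm of the restriction of `α` to a finite set. -/
noncomputable def lpSum (p : ℝ) (α : ℕ → ℝ) (T : Finset ℕ) : ℝ := (∑ i ∈ T, α i ^ p) ^ (1 / p)

theorem lpSum_nonneg {p : ℝ} {α : ℕ → ℝ} (hα : ∀ i, 0 ≤ α i) (T : Finset ℕ) :
    0 ≤ lpSum p α T :=
  Real.rpow_nonneg (Finset.sum_nonneg fun i _ => Real.rpow_nonneg (hα i) p) _

theorem lpSum_rpow {p : ℝ} (hp : 1 < p) {α : ℕ → ℝ} (hα : ∀ i, 0 ≤ α i) (T : Finset ℕ) :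
    lpSum p α T ^ p = ∑ i ∈ T, α i ^ p := by
  rw [lpSum, ← Real.rpow_mul (Finset.sum_nonneg fun i _ => Real.rpow_nonneg (hα i) p),
    one_div_mul_cancel (by positivity), Real.rpow_one]

theorem lpSum_mono {p : ℝ} (hp : 1 < p) {α : ℕ → ℝ} (hα : ∀ i, 0 ≤ α i) {T T' : Finset ℕ}
    (h : T ⊆ T') : lpSum p α T ≤ lpSum p α T' :=
  Real.rpow_le_rpow (Finset.sum_nonneg fun i _ => Real.rpow_nonneg (hα i) p)
    (Finset.sum_le_sum_of_subset_of_nonneg h fun i _ _ => Real.rpow_nonneg (hα i) p)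
    (by positivity)

theorem le_lpSum {p : ℝ} (hp : 1 < p) {α : ℕ → ℝ} (hα : ∀ i, 0 ≤ α i) {T : Finset ℕ} {i : ℕ}
    (hi : i ∈ T) : α i ≤ lpSum p α T := by
  refine le_of_eq_of_le ?_ (lpSum_mono hp hα (Finset.singleton_subset_iff.2 hi))
  rw [lpSum, Finset.sum_singleton, ← Real.rpow_mul (hα i),
    mul_one_div_cancel (by positivity), Real.rpow_one]

/-- Hölder's inequality for at most `d` pairwise disjoint pieces. -/
theorem mul_sum_lpSum_le {d m : ℕ} (hd : 2 ≤ d) {θ p : ℝ} (hθ0 : 0 < θ) (hp : 1 < p)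
    (hdp : (d : ℝ) * θ = (d : ℝ) ^ (1 / p)) {α : ℕ → ℝ} (hα : ∀ i, 0 ≤ α i) (hm : m ≤ d)
    {P : Fin m → Finset ℕ} {Q : Finset ℕ} (hP : ∀ e, P e ⊆ Q)
    (hdisj : ∀ e e', e < e' → Disjoint (P e) (P e')) :
    θ * ∑ e, lpSum p α (P e) ≤ lpSum p α Q := by
  have hd0 : (0 : ℝ) < d := by exact_mod_cast (by omega : 0 < d)
  have hp0 : 0 < p := by positivity
  have hsum0 : 0 ≤ ∑ e, lpSum p α (P e) := Finset.sum_nonneg fun e _ => lpSum_nonneg hα _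
  have hθp : θ ^ p * (d : ℝ) ^ (p - 1) = 1 := by
    have hθ : θ = (d : ℝ) ^ (1 / p - 1) := by
      rw [Real.rpow_sub hd0, Real.rpow_one, ← hdp, mul_div_cancel_left₀ _ hd0.ne']
    rw [hθ, ← Real.rpow_mul hd0.le, ← Real.rpow_add hd0]
    have : (1 / p - 1) * p + (p - 1) = 0 := by field_simp; ring
    rw [this, Real.rpow_zero]
  refine (Real.rpow_le_rpow_iff (mul_nonneg hθ0.le hsum0) (lpSum_nonneg hα _) hp0).1 ?_
  have hcard : (Finset.univ : Finset (Fin m)).card = m := by simp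
  have h := Real.rpow_sum_le_const_mul_sum_rpow Finset.univ (fun e => lpSum p α (P e)) hp.le
  simp only [abs_of_nonneg (lpSum_nonneg hα _), lpSum_rpow hp hα, hcard] at h
  have hPQ : ∑ e, ∑ i ∈ P e, α i ^ p ≤ ∑ i ∈ Q, α i ^ p := by
    rw [← Finset.sum_biUnion]
    · exact Finset.sum_le_sum_of_subset_of_nonneg (Finset.biUnion_subset.2 fun e _ => hP e)
        fun i _ _ => Real.rpow_nonneg (hα i) p
    · intro e _ e' _ hne
      rcases lt_or_gt_of_ne hne with h | h
      · exact hdisj _ _ h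
      · exact (hdisj _ _ h).symm
  have hmd : (m : ℝ) ^ (p - 1) ≤ (d : ℝ) ^ (p - 1) :=
    Real.rpow_le_rpow (by positivity) (by exact_mod_cast hm) (by linarith)
  have hQ0 : 0 ≤ ∑ i ∈ Q, α i ^ p := Finset.sum_nonneg fun i _ => Real.rpow_nonneg (hα i) p
  rw [Real.mul_rpow hθ0.le hsum0, lpSum_rpow hp hα]
  calc θ ^ p * (∑ e, lpSum p α (P e)) ^ p
      ≤ θ ^ p * ((d : ℝ) ^ (p - 1) * ∑ i ∈ Q, α i ^ p) := by
        refine mul_le_mul_of_nonneg_left (h.trans ?_) (by positivity)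
        exact (mul_le_mul_of_nonneg_left hPQ (by positivity)).trans
          (mul_le_mul_of_nonneg_right hmd hQ0)
    _ = ∑ i ∈ Q, α i ^ p := by rw [← mul_assoc, hθp, one_mul]

/-- A finite sequence of finite sets of integers, consecutive ones sharing at most an end point, is
split into the set `Z` of the members of singletons and two sequences of pairwise disjoint pieces. -/
theorem exists_disjoint_pieces {m : ℕ} {T : Fin m → Finset ℕ} {S : Finset ℕ} {σ τ : ℕ}
    (hTS : ∀ e, T e ⊆ S) (hS : S ⊆ Finset.Icc σ τ) (hστ : σ < τ)
    (hT : ∀ e e', e < e' → ∀ i ∈ T e, ∀ i' ∈ T e', i ≤ i') :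
    ∃ (Z : Finset ℕ) (f : Z → Fin m) (A B : Fin m → Finset ℕ), Function.Injective f ∧
      (∀ i, (T (f i)).card ≤ 1 ∧ (i.1 ∈ A (f i) ∨ i.1 ∈ B (f i))) ∧
      (∀ e, (T e).card ≤ 1 → T e ⊆ Z) ∧
      (∀ e, 1 < (T e).card → ∃ l u, l < u ∧ T e ⊆ Finset.Icc l u ∧
        A e = (T e \ Z).erase l ∧ B e = (T e \ Z).erase u) ∧
      (∀ e, A e ⊆ S.erase σ) ∧ (∀ e, B e ⊆ S.erase τ) ∧
      (∀ e e', e < e' → Disjoint (A e) (A e')) ∧ (∀ e e', e < e' → Disjoint (B e) (B e')) := by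
  classical
  set Z := S.filter fun i => ∃ e, T e = {i} with hZ
  have hex : ∀ i : Z, ∃ e, T e = {i.1} := fun i => (Finset.mem_filter.1 i.2).2
  choose f hf using hex
  have hlu : ∀ e, ∃ l u, (1 < (T e).card → l < u ∧ T e ⊆ Finset.Icc l u ∧ l ∈ T e ∧ u ∈ T e) ∧
      (¬ 1 < (T e).card → l = σ ∧ u = τ) := by
    intro e
    by_cases h : 1 < (T e).card
    · have hne : (T e).Nonempty := Finset.card_pos.1 (by omega)
      exact ⟨(T e).min' hne, (T e).max' hne, fun _ =>
        ⟨Finset.min'_lt_max'_of_card _ h,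
          fun i hi => Finset.mem_Icc.2 ⟨Finset.min'_le _ _ hi, Finset.le_max' _ _ hi⟩,
          Finset.min'_mem _ _, Finset.max'_mem _ _⟩, fun h' => absurd h h'⟩
    · exact ⟨σ, τ, fun h' => absurd h' h, fun _ => ⟨rfl, rfl⟩⟩
  choose l u hbig hsmall using hlu
  set P : Fin m → Finset ℕ := fun e => if 1 < (T e).card then T e \ Z else
    Z.filter fun i => ∃ h : i ∈ Z, f ⟨i, h⟩ = e with hP
  have hPbig : ∀ e, 1 < (T e).card → P e = T e \ Z := fun e h => if_pos h
  have hPsmall : ∀ e, ¬ 1 < (T e).card → ∀ i, i ∈ P e ↔ ∃ h : i ∈ Z, f ⟨i, h⟩ = e := by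
    intro e h i
    simp only [hP, if_neg h, Finset.mem_filter]
    exact ⟨fun h => h.2, fun h => ⟨h.1, h⟩⟩
  have hPT : ∀ e, P e ⊆ T e := by
    intro e i hi
    by_cases h : 1 < (T e).card
    · exact (Finset.mem_sdiff.1 (hPbig e h ▸ hi)).1
    · obtain ⟨h', rfl⟩ := (hPsmall e h i).1 hi
      rw [hf]
      exact Finset.mem_singleton_self i
  have hcommon : ∀ e e', e < e' → ∀ i, i ∈ P e → i ∈ P e' →
      1 < (T e).card ∧ 1 < (T e').card := by
    intro e e' hee i hi hi'
    by_cases h : 1 < (T e).card <;> by_cases h' : 1 < (T e').card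
    · exact ⟨h, h'⟩
    · exact absurd ((hPsmall e' h' i).1 hi').1 (Finset.mem_sdiff.1 (hPbig e h ▸ hi)).2
    · exact absurd ((hPsmall e h i).1 hi).1 (Finset.mem_sdiff.1 (hPbig e' h' ▸ hi')).2
    · obtain ⟨_, h1⟩ := (hPsmall e h i).1 hi
      obtain ⟨_, h2⟩ := (hPsmall e' h' i).1 hi'
      exact absurd (h1.symm.trans h2) hee.ne
  have hfinj : Function.Injective f := by
    intro i i' h
    have := (hf i).symm.trans ((congrArg T h).trans (hf i'))
    exact Subtype.ext (Finset.singleton_injective this)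
  have hfcard : ∀ i, (T (f i)).card = 1 := fun i => by rw [hf, Finset.card_singleton]
  refine ⟨Z, f, fun e => (P e).erase (l e), fun e => (P e).erase (u e), hfinj,
    fun i => ⟨(hfcard i).le, ?_⟩, ?_,
    fun e h => ⟨l e, u e, (hbig e h).1, (hbig e h).2.1, by rw [← hPbig e h], by rw [← hPbig e h]⟩,
    ?_, ?_, ?_, ?_⟩
  · have hn : ¬ 1 < (T (f i)).card := by rw [hfcard]; omega
    have hiP : i.1 ∈ P (f i) := (hPsmall _ hn _).2 ⟨i.2, rfl⟩
    simp only [Finset.mem_erase, (hsmall _ hn).1, (hsmall _ hn).2]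
    by_cases h : i.1 = σ
    · exact Or.inr ⟨by omega, hiP⟩
    · exact Or.inl ⟨h, hiP⟩
  · intro e h i hi
    refine Finset.mem_filter.2 ⟨hTS e hi, e, Finset.eq_singleton_iff_unique_mem.2 ⟨hi, ?_⟩⟩
    exact fun j hj => Finset.card_le_one.1 h j hj i hi
  · intro e i hi
    obtain ⟨hil, hi⟩ := Finset.mem_erase.1 hi
    refine Finset.mem_erase.2 ⟨?_, hTS e (hPT e hi)⟩
    by_cases h : 1 < (T e).card
    · have h1 := Finset.mem_Icc.1 ((hbig e h).2.1 (hPT e hi))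
      have h2 := Finset.mem_Icc.1 (hS (hTS e (hbig e h).2.2.1))
      omega
    · exact (hsmall e h).1 ▸ hil
  · intro e i hi
    obtain ⟨hil, hi⟩ := Finset.mem_erase.1 hi
    refine Finset.mem_erase.2 ⟨?_, hTS e (hPT e hi)⟩
    by_cases h : 1 < (T e).card
    · have h1 := Finset.mem_Icc.1 ((hbig e h).2.1 (hPT e hi))
      have h2 := Finset.mem_Icc.1 (hS (hTS e (hbig e h).2.2.2))
      omega
    · exact (hsmall e h).2 ▸ hil
  · intro e e' hee
    refine Finset.disjoint_left.2 fun i hi hi' => ?_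
    obtain ⟨-, hi⟩ := Finset.mem_erase.1 hi
    obtain ⟨hil, hi'⟩ := Finset.mem_erase.1 hi'
    obtain ⟨h, h'⟩ := hcommon e e' hee i hi hi'
    have h1 := hT e e' hee i (hPT e hi) _ (hbig e' h').2.2.1
    have h2 := Finset.mem_Icc.1 ((hbig e' h').2.1 (hPT e' hi'))
    omega
  · intro e e' hee
    refine Finset.disjoint_left.2 fun i hi hi' => ?_
    obtain ⟨hil, hi⟩ := Finset.mem_erase.1 hi
    obtain ⟨-, hi'⟩ := Finset.mem_erase.1 hi'
    obtain ⟨h, h'⟩ := hcommon e e' hee i hi hi'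
    have h1 := hT e e' hee _ (hbig e h).2.2.2 i (hPT e' hi')
    have h2 := Finset.mem_Icc.1 ((hbig e h).2.1 (hPT e hi))
    omega

variable {k d : ℕ} {θ p : ℝ} {α : ℕ → ℝ}

theorem normSeq_zero_sum_le (hp : 1 < p) (hα : ∀ i, 0 ≤ α i) (hθ0 : 0 < θ) (hθ1 : θ < 1)
    {y : ℕ → (Vec k →₀ ℝ)}
    (hy : ∀ i j, i < j → ∀ w ∈ (y i).support, ∀ w' ∈ (y j).support, prec w.1 w'.1)
    (hyα : ∀ i, tnorm k d θ (y i) ≤ α i) {S : Finset ℕ} {σ τ : ℕ} (hστ : σ < τ) :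
    normSeq k d θ 0 (∑ i ∈ S, y i) ≤
      1 / θ * (lpSum p α (S.erase σ) + lpSum p α (S.erase τ)) := by
  have h0 : 0 ≤ lpSum p α (S.erase σ) + lpSum p α (S.erase τ) :=
    add_nonneg (lpSum_nonneg hα _) (lpSum_nonneg hα _)
  refine le_trans ?_ (le_mul_of_one_le_left h0 ((one_le_div hθ0).2 hθ1.le))
  refine Real.iSup_le (fun w => ?_) h0
  rw [Finsupp.finsetSum_apply]
  by_cases hw : ∃ i ∈ S, y i w ≠ 0
  · obtain ⟨i, hi, hiw⟩ := hw
    have hother : ∀ j ∈ S, j ≠ i → y j w = 0 := by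
      intro j _ hji
      by_contra hjw
      replace hiw := Finsupp.mem_support_iff.2 hiw
      replace hjw := Finsupp.mem_support_iff.2 hjw
      rcases lt_or_gt_of_ne hji with h | h
      · exact prec_irrefl _ (hy _ _ h w hjw w hiw)
      · exact prec_irrefl _ (hy _ _ h w hiw w hjw)
    rw [Finset.sum_eq_single_of_mem i hi hother]
    have hle : |y i w| ≤ α i := (abs_apply_le_normSeq_zero (d := d) (θ := θ) _ _).trans
      ((normSeq_le_tnorm hθ0 hθ1 0 _).trans (hyα i))
    by_cases h : i = σ
    · exact hle.trans ((le_lpSum hp hα (Finset.mem_erase.2 ⟨by omega, hi⟩)).trans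
        (le_add_of_nonneg_left (lpSum_nonneg hα _)))
    · exact hle.trans ((le_lpSum hp hα (Finset.mem_erase.2 ⟨h, hi⟩)).trans
        (le_add_of_nonneg_right (lpSum_nonneg hα _)))
  · push Not at hw
    rw [Finset.sum_eq_zero hw, abs_zero]
    exact h0

theorem normSeq_sum_block_le (hd : 2 ≤ d) (hθ0 : 0 < θ) (hθ1 : θ < 1) (hp : 1 < p)
    (hdp : (d : ℝ) * θ = (d : ℝ) ^ (1 / p)) (hα : ∀ i, 0 ≤ α i) (j : ℕ)
    {y : ℕ → (Vec k →₀ ℝ)}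
    (hy : ∀ i j, i < j → ∀ w ∈ (y i).support, ∀ w' ∈ (y j).support, prec w.1 w'.1)
    (hyα : ∀ i, tnorm k d θ (y i) ≤ α i) {S : Finset ℕ} {σ τ : ℕ} (hστ : σ < τ)
    (hS : S ⊆ Finset.Icc σ τ) :
    normSeq k d θ j (∑ i ∈ S, y i) ≤
      1 / θ * (lpSum p α (S.erase σ) + lpSum p α (S.erase τ)) := by
  classical
  induction j generalizing y S σ τ with
  | zero => exact normSeq_zero_sum_le hp hα hθ0 hθ1 hy hyα hστ
  | succ j ih =>
    refine normSeq_succ_le (ih hy hyα hστ hS) fun m E hE => ?_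
    set T : Fin m → Finset ℕ := fun e => S.filter fun i => restrict (E e) (y i) ≠ 0 with hTdef
    have hTmono : ∀ e e', e < e' → ∀ i ∈ T e, ∀ i' ∈ T e', i ≤ i' := by
      intro e e' hee i hi i' hi'
      by_contra! hlt
      obtain ⟨w, hw⟩ := Finsupp.support_nonempty_iff.2 (Finset.mem_filter.1 hi).2
      obtain ⟨w', hw'⟩ := Finsupp.support_nonempty_iff.2 (Finset.mem_filter.1 hi').2
      obtain ⟨hwE, hw⟩ := mem_of_mem_support_restrict hw
      obtain ⟨hwE', hw'⟩ := mem_of_mem_support_restrict hw'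
      exact prec_asymm (hE.2.2 e e' hee w hwE w' hwE') (hy _ _ hlt w' hw' w hw)
    obtain ⟨Z, f, A, B, hf, hfZ, hsmall, hbig, hAS, hBS, hA, hB⟩ :=
      exists_disjoint_pieces (fun e => Finset.filter_subset _ _) hS hστ hTmono
    set g : Fin m → ℝ := fun e => lpSum p α (A e) + lpSum p α (B e) with hg
    have hg0 : ∀ e, 0 ≤ g e := fun e => add_nonneg (lpSum_nonneg hα _) (lpSum_nonneg hα _)
    have hpart : ∀ e, normSeq k d θ j (restrict (E e) (∑ i ∈ S, y i)) ≤
        1 / θ * (if 1 < (T e).card then g e else 0) +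
          ∑ i ∈ Z, normSeq k d θ j (restrict (E e) (y i)) := by
      intro e
      have hsplit : restrict (E e) (∑ i ∈ S, y i) =
          ∑ i ∈ T e \ Z, restrict (E e) (y i) + ∑ i ∈ T e ∩ Z, restrict (E e) (y i) := by
        rw [restrict_sum, add_comm, Finset.sum_inter_add_sum_sdiff]
        exact (Finset.sum_filter_ne_zero S).symm
      rw [hsplit]
      refine (normSeq_add_le hθ0 hθ1 j _ _).trans (add_le_add ?_ ?_)
      · by_cases h : 1 < (T e).card
        · obtain ⟨l, u, hlu, hT, hAe, hBe⟩ := hbig e h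
          rw [if_pos h, hg]
          simp only [hAe, hBe]
          refine ih (y := fun i => restrict (E e) (y i)) ?_ ?_ hlu
            (Finset.sdiff_subset.trans hT)
          · exact fun i i' hii w hw w' hw' => hy i i' hii w (support_restrict_subset _ _ hw) w'
              (support_restrict_subset _ _ hw')
          · exact fun i => (tnorm_restrict_le hθ0 hθ1 _ _).trans (hyα i)
        · rw [if_neg h, mul_zero, Finset.sdiff_eq_empty_iff_subset.2 (hsmall e (not_lt.1 h)),
            Finset.sum_empty, normSeq_zero_right hθ0 hθ1]
      · refine (normSeq_sum_le hθ0 hθ1 j _ _).trans ?_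
        exact Finset.sum_le_sum_of_subset_of_nonneg Finset.inter_subset_right
          fun i _ _ => normSeq_nonneg j _
    have hZ : ∀ i, ∑ e, normSeq k d θ j (restrict (E e) (y i)) ≤ 1 / θ * α i := by
      intro i
      rw [one_div, inv_mul_eq_div, le_div_iff₀' hθ0]
      exact (hE.le_normSeq_succ hθ0 hθ1 j _).trans
        ((normSeq_le_tnorm hθ0 hθ1 _ _).trans (hyα i))
    have hZsum : ∑ i ∈ Z, α i ≤ ∑ e, if 1 < (T e).card then 0 else g e := by
      rw [← Finset.sum_coe_sort]
      calc ∑ i : Z, α i ≤ ∑ i : Z, if 1 < (T (f i)).card then 0 else g (f i) := by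
            refine Finset.sum_le_sum fun i _ => ?_
            obtain ⟨h1, h2⟩ := hfZ i
            rw [if_neg h1.not_gt]
            rcases h2 with h2 | h2
            · exact (le_lpSum hp hα h2).trans (le_add_of_nonneg_right (lpSum_nonneg hα _))
            · exact (le_lpSum hp hα h2).trans (le_add_of_nonneg_left (lpSum_nonneg hα _))
        _ = ∑ e ∈ Finset.univ.image f, if 1 < (T e).card then 0 else g e :=
            (Finset.sum_image (f := fun e => if 1 < (T e).card then 0 else g e)
              fun i _ i' _ h => hf h).symm
        _ ≤ _ := by
            refine Finset.sum_le_sum_of_subset_of_nonneg (Finset.subset_univ _) fun e _ _ => ?_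
            split_ifs
            · exact le_rfl
            · exact hg0 e
    have htotal : ∑ e, normSeq k d θ j (restrict (E e) (∑ i ∈ S, y i)) ≤
        1 / θ * ∑ e, g e := by
      refine (Finset.sum_le_sum fun e _ => hpart e).trans ?_
      rw [Finset.sum_add_distrib, ← Finset.mul_sum, Finset.sum_comm]
      have h1 : ∑ i ∈ Z, ∑ e, normSeq k d θ j (restrict (E e) (y i)) ≤
          1 / θ * ∑ e, if 1 < (T e).card then 0 else g e := by
        refine (Finset.sum_le_sum fun i _ => hZ i).trans ?_
        rw [← Finset.mul_sum]
        exact mul_le_mul_of_nonneg_left hZsum (by positivity)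
      refine (add_le_add_right h1 _).trans (le_of_eq ?_)
      rw [← mul_add, ← Finset.sum_add_distrib]
      refine congrArg _ (Finset.sum_congr rfl fun e _ => ?_)
      split_ifs <;> simp
    calc θ * ∑ e, normSeq k d θ j (restrict (E e) (∑ i ∈ S, y i))
        ≤ θ * (1 / θ * ∑ e, g e) := mul_le_mul_of_nonneg_left htotal hθ0.le
      _ = 1 / θ * (θ * ∑ e, lpSum p α (A e) + θ * ∑ e, lpSum p α (B e)) := by
          rw [hg, Finset.sum_add_distrib]
          ring
      _ ≤ _ := mul_le_mul_of_nonneg_left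
          (add_le_add (mul_sum_lpSum_le hd hθ0 hp hdp hα hE.1 hAS hA)
            (mul_sum_lpSum_le hd hθ0 hp hdp hα hE.1 hBS hB)) (by positivity)

theorem tnorm_sum_block_le (hd : 2 ≤ d) (hθ0 : 0 < θ) (hθ1 : θ < 1) (hp : 1 < p)
    (hdp : (d : ℝ) * θ = (d : ℝ) ^ (1 / p)) (hα : ∀ i, 0 ≤ α i) {y : ℕ → (Vec k →₀ ℝ)}
    (hy : ∀ i j, i < j → ∀ w ∈ (y i).support, ∀ w' ∈ (y j).support, prec w.1 w'.1)
    (hyα : ∀ i, tnorm k d θ (y i) ≤ α i) (N : ℕ) :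
    tnorm k d θ (∑ i ∈ Finset.range N, y i) ≤ 2 / θ * lpSum p α (Finset.range N) := by
  refine tnorm_le fun j => (normSeq_sum_block_le hd hθ0 hθ1 hp hdp hα j hy hyα
    (σ := 0) (τ := N + 1) (by omega) fun i hi => ?_).trans ?_
  · have := Finset.mem_range.1 hi
    exact Finset.mem_Icc.2 ⟨by omega, by omega⟩
  · rw [div_mul_eq_mul_div, one_mul, div_mul_eq_mul_div, two_mul]
    gcongr <;> exact lpSum_mono hp hα (Finset.erase_subset _ _)

end Upper

/-- a normalized block sequence `(x_i)` with markers
`v_1 ≤ x_1 < v_2 ≤ x_2 < ⋯`, `supp(x_i) ⊆ X_{v_i}^max`, `v_{i+1} ∈ X_{v_i}^max`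
satisfies the `ℓ_p` estimates `(1/(2d))‖a‖_p ≤ ‖∑ a_i x_i‖ ≤ (2/θ)‖a‖_p`,
where `dθ = d^{1/p}`;  in particular it is equivalent to the `ℓ_p` basis. -/
theorem block_sequence_lp (k d : ℕ) (hd : 2 ≤ d) (θ : ℝ) (hθ0 : 0 < θ) (hθ1 : θ < 1)
    (hdθ : 1 < (d : ℝ) * θ) (p : ℝ) (hp : 1 < p)
    (hdp : (d : ℝ) * θ = (d : ℝ) ^ (1 / p))
    (x : ℕ → (Vec k →₀ ℝ)) (hxnorm : ∀ i, tnorm k d θ (x i) = 1)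
    (hblock : ∀ i j, i < j → ∀ w ∈ (x i).support, ∀ w' ∈ (x j).support, prec w.1 w'.1)
    (v : ℕ → Vec k)
    (h1 : ∀ i, ∀ w ∈ (x i).support,
      (v i = w ∨ prec (v i).1 w.1) ∧ prec w.1 (v (i + 1)).1)
    (h2 : ∀ i, ∀ w ∈ (x i).support, w.1 ∈ XmaxSet (v i).1)
    (h3 : ∀ i, (v (i + 1)).1 ∈ XmaxSet (v i).1)
    (N : ℕ) (a : Fin N → ℝ) :
    (1 / (2 * (d : ℝ))) * (∑ i, |a i| ^ p) ^ (1 / p)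
        ≤ tnorm k d θ (∑ i, a i • x i) ∧
    tnorm k d θ (∑ i, a i • x i) ≤ (2 / θ) * (∑ i, |a i| ^ p) ^ (1 / p) := by
  have hx : ∀ i, x i ≠ 0 := by
    intro i h
    have := hxnorm i
    rw [h, tnorm_zero hθ0 hθ1] at this
    exact zero_ne_one this
  set b : ℕ → ℝ := fun i => if h : i < N then a ⟨i, h⟩ else 0 with hb
  have hab : ∀ i : Fin N, a i = b i := fun i => by simp [hb]
  have hsum : ∑ i, a i • x i = ∑ i ∈ Finset.range N, b i • x i := by
    simp only [hab]
    exact (Finset.sum_range fun i => b i • x i).symm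
  have hpow : ∑ i, |a i| ^ p = ∑ i ∈ Finset.range N, |b i| ^ p := by
    simp only [hab]
    exact (Finset.sum_range fun i => |b i| ^ p).symm
  have hnorm : ∀ i, tnorm k d θ (b i • x i) = |b i| := fun i => by
    rw [tnorm_smul hθ0 hθ1, hxnorm, mul_one]
  rw [hsum, hpow]
  constructor
  · have h := lp_le_of_superadditive hd hθ0 hp hdp (α := fun i => |b i|)
      (g := fun s => tnorm k d θ (∑ i ∈ s, b i • x i)) (fun s => tnorm_nonneg _)
      (fun i => by rw [Finset.sum_singleton, hnorm])
      (mul_sum_tnorm_le hθ0 hθ1 h1 h2 h3 hx b)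
      ((Finset.range N).filter fun i => b i ≠ 0)
      (fun i hi => abs_pos.2 (Finset.mem_filter.1 hi).2)
    rwa [Finset.sum_filter_of_ne, Finset.sum_filter_of_ne] at h
    · intro i _ hi hbi
      rw [hbi, zero_smul] at hi
      exact hi rfl
    · intro i _ hi hbi
      rw [hbi, abs_zero, Real.zero_rpow (by positivity)] at hi
      exact hi rfl
  · refine tnorm_sum_block_le hd hθ0 hθ1 hp hdp (fun i => abs_nonneg (b i)) ?_
      (fun i => (hnorm i).le) N
    exact fun i j hij w hw w' hw' => hblock i j hij w (Finsupp.support_smul hw) w'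
      (Finsupp.support_smul hw')
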